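/- Assume Condition (C2). Then 0 < liminf_{x→∞} σ̂₀²(x)/φ(x) ≤ limsup_{x→∞} σ̂₀²(x)/φ(x) < ∞; that is, the maximal variance function σ̂₀² and the tail function φ are comparable at infinity. -/

import Mathlib

open MeasureTheory Filter Set Topology

/-- The tail function of the Lévy measure ν(dx) = dx/θ(x):
    π(x) = 2∫_{1/x}^∞ dz/θ(z). -/
noncomputable def piF (θ : ℝ → ℝ) (x : ℝ) : ℝ :=
  2 * ∫ z in Set.Ioi (1 / x), 1 / θ z

/-- The characteristic exponent ψ(λ) = ∫₀^∞ (1 − cos(xλ)) dx/θ(x). -/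
noncomputable def psiF (θ : ℝ → ℝ) (l : ℝ) : ℝ :=
  ∫ x in Set.Ioi (0 : ℝ), (1 - Real.cos (x * l)) / θ x

/-- φ(x) = 2∫_{1/x}^∞ dλ/ψ(λ). -/
noncomputable def phiF (θ : ℝ → ℝ) (x : ℝ) : ℝ :=
  2 * ∫ l in Set.Ioi (1 / x), 1 / psiF θ l

/-- σ₀²(x) = (2/π)∫₀^∞ (1 − cos(λx)) dλ/ψ(λ). -/
noncomputable def sigma0sq (θ : ℝ → ℝ) (x : ℝ) : ℝ :=
  (2 / Real.pi) * ∫ l in Set.Ioi (0 : ℝ), (1 - Real.cos (l * x)) / psiF θ l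

/-- σ̂₀²(h) = sup_{|x| ≤ h} σ₀²(x). -/
noncomputable def sigma0sqHat (θ : ℝ → ℝ) (h : ℝ) : ℝ :=
  sSup (sigma0sq θ '' {x : ℝ | |x| ≤ h})

/-- H(x) = ∫₀^∞ min(1, (λ/x)²) dλ/ψ(λ). -/
noncomputable def Hfun (θ : ℝ → ℝ) (x : ℝ) : ℝ :=
  ∫ l in Set.Ioi (0 : ℝ), min 1 ((l / x) ^ 2) / psiF θ l

/-- Standing assumptions on θ: measurability, positivity on (0,∞), and
    ∫₀^∞ min(1, x²)/θ(x) dx < ∞, so that ν(dx) = dx/θ(x) is the Lévy measure of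
    a symmetric pure-jump Lévy process. -/
def ThetaOK (θ : ℝ → ℝ) : Prop :=
  Measurable θ ∧ (∀ x ∈ Set.Ioi (0 : ℝ), 0 < θ x) ∧
    MeasureTheory.IntegrableOn (fun x => min 1 (x ^ 2) / θ x) (Set.Ioi 0)

/-- Existence of local times: ∫₁^∞ dλ/ψ(λ) < ∞. -/
def PsiIntegrable (θ : ℝ → ℝ) : Prop :=
  MeasureTheory.IntegrableOn (fun l => 1 / psiF θ l) (Set.Ioi 1)

/-- Condition (C1): 1 < α̲ ≤ ᾱ < 2, where α̲ and ᾱ are the liminf and the limsup, as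
    x → 0⁺, of (x/θ(x))/ν({z : |z| ≥ x}) = (x/θ(x))/π(1/x) (which is in particular
    eventually bounded above since the limsup is finite). -/
def CondC1 (θ : ℝ → ℝ) (al ah : ℝ) : Prop :=
  1 < al ∧ al ≤ ah ∧ ah < 2 ∧
  Filter.IsBoundedUnder (· ≤ ·) (𝓝[>] (0 : ℝ))
    (fun x => (x / θ x) / piF θ (1 / x)) ∧
  Filter.liminf (fun x => (x / θ x) / piF θ (1 / x)) (𝓝[>] (0 : ℝ)) = al ∧
  Filter.limsup (fun x => (x / θ x) / piF θ (1 / x)) (𝓝[>] (0 : ℝ)) = ah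

/-- Condition (C2): 1 < β̲ ≤ β̄ < 2, where β̲ and β̄ are the liminf and the limsup, as
    x → ∞, of (x/θ(x))/ν({z : |z| ≥ x}) = (x/θ(x))/π(1/x). -/
def CondC2 (θ : ℝ → ℝ) (bl bh : ℝ) : Prop :=
  1 < bl ∧ bl ≤ bh ∧ bh < 2 ∧
  Filter.IsBoundedUnder (· ≤ ·) Filter.atTop
    (fun x => (x / θ x) / piF θ (1 / x)) ∧
  Filter.liminf (fun x => (x / θ x) / piF θ (1 / x)) Filter.atTop = bl ∧
  Filter.limsup (fun x => (x / θ x) / piF θ (1 / x)) Filter.atTop = bh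


lemma aux_tail_int {θ : ℝ → ℝ} (hθ : ThetaOK θ) {X : ℝ} (hX : 0 < X) :
    IntegrableOn (fun x => 1 / θ x) (Ioi X) := by
  obtain ⟨hm, hp, hi⟩ := hθ
  have h1 : IntegrableOn (fun x => (min 1 (X^2))⁻¹ * (min 1 (x ^ 2) / θ x)) (Ioi X) :=
    (hi.mono_set (Ioi_subset_Ioi hX.le)).const_mul _
  refine Integrable.mono' h1 (Measurable.aestronglyMeasurable (by fun_prop)) ?_
  filter_upwards [ae_restrict_mem measurableSet_Ioi] with x hx
  have hx : X < x := hx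
  have hθx := hp x (hX.trans hx)
  have hc : 0 < min 1 (X^2) := by positivity
  have hle : min 1 (X^2) ≤ min 1 (x^2) := min_le_min le_rfl (by gcongr)
  rw [Real.norm_of_nonneg (by positivity), ← mul_div_assoc, ← div_eq_inv_mul]
  gcongr
  rwa [one_le_div hc]

lemma aux_sq_loc {θ : ℝ → ℝ} (hθ : ThetaOK θ) {N : ℝ} (hN : 1 ≤ N) :
    IntegrableOn (fun x => x ^ 2 / θ x) (Ioc 0 N) := by
  obtain ⟨hm, hp, hi⟩ := hθ
  have h1 : IntegrableOn (fun x => N^2 * (min 1 (x ^ 2) / θ x)) (Ioc 0 N) :=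
    (hi.mono_set Ioc_subset_Ioi_self).const_mul _
  refine Integrable.mono' h1 (Measurable.aestronglyMeasurable (by fun_prop)) ?_
  filter_upwards [ae_restrict_mem measurableSet_Ioc] with x hx
  have hx0 : 0 < x := hx.1
  have hθx := hp x hx0
  rw [Real.norm_of_nonneg (by positivity), ← mul_div_assoc]
  gcongr
  rcases min_cases 1 (x^2) with h | h
  · rw [h.1, mul_one]; have := hx.2; gcongr
  · rw [h.1]; exact le_mul_of_one_le_left (sq_nonneg x) (one_le_pow₀ hN)

lemma aux_lin {θ : ℝ → ℝ} (hθ : ThetaOK θ) {m X : ℝ} (hm1 : 1 < m) (hX : 1 ≤ X)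
    (h : ∀ x, X ≤ x → 2 * m * (∫ z in Ioi x, 1 / θ z) ≤ x / θ x) {N : ℝ} (hN : X ≤ N) :
    ∫ x in Ioc X N, x ^ 2 / θ x ≤
      2 * X * X * (∫ z in Ioi X, 1 / θ z) + (1 / m) * ∫ x in Ioc X N, x ^ 2 / θ x := by
  have hX0 : 0 < X := by linarith
  have hθ' := hθ
  obtain ⟨hm, hp, hi⟩ := hθ
  have hpos : ∀ x ∈ Ioi (0:ℝ), 0 ≤ 1 / θ x := fun x hx => by have := hp x hx; positivity
  have hT0 : ∀ t, X ≤ t → 0 ≤ ∫ z in Ioi t, 1 / θ z := fun t ht =>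
    setIntegral_nonneg measurableSet_Ioi fun z hz => hpos z (lt_trans (by linarith : (0:ℝ) < t) hz)
  have hsq : IntegrableOn (fun x => x ^ 2 / θ x) (Ioc X N) :=
    (aux_sq_loc hθ' (by linarith)).mono_set (Ioc_subset_Ioc_left hX0.le)
  have hsq0 : 0 ≤ᵐ[volume.restrict (Ioc X N)] (fun x => x ^ 2 / θ x) := by
    filter_upwards [ae_restrict_mem measurableSet_Ioc] with x hx
    have := hp x (hX0.trans hx.1)
    simp only [Pi.zero_apply]; positivity
  set μ : Measure ℝ := (volume.restrict (Ioc X N)).withDensity (fun x => ENNReal.ofReal (1 / θ x))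
    with hμ
  have hdm : Measurable (fun x => ENNReal.ofReal (1 / θ x)) := by fun_prop
  have hμle : ∀ t, X ≤ t → μ {a | t ≤ a} ≤ ENNReal.ofReal (∫ z in Ioi t, 1 / θ z) := by
    intro t ht
    rw [ofReal_integral_eq_lintegral_ofReal (aux_tail_int hθ' (hX0.trans_le ht))
      (by filter_upwards [ae_restrict_mem measurableSet_Ioi] with z hz
          exact hpos z (lt_trans (by linarith : (0:ℝ) < t) hz)), hμ,
      withDensity_apply _ (measurableSet_le measurable_const measurable_id' : MeasurableSet {a : ℝ | t ≤ a}),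
      Measure.restrict_restrict (measurableSet_le measurable_const measurable_id'), restrict_Ioi_eq_restrict_Ici]
    exact lintegral_mono_set inter_subset_left
  have lc := lintegral_comp_eq_lintegral_meas_le_mul μ (f := fun x => x) (g := fun t => 2 * t)
    (by
      rw [hμ]
      refine (withDensity_absolutelyContinuous _ _).ae_le ?_
      filter_upwards [ae_restrict_mem measurableSet_Ioc] with x hx
      exact (hX0.trans hx.1).le) (by fun_prop)
    (fun t _ => (by fun_prop : Continuous fun t : ℝ => 2 * t).intervalIntegrable _ _)
    (by filter_upwards [ae_restrict_mem measurableSet_Ioi] with x hx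
        have : (0:ℝ) < x := hx
        positivity)
  have hprim : ∀ x : ℝ, ∫ t in (0:ℝ)..x, 2 * t = x ^ 2 := by
    intro x; rw [intervalIntegral.integral_const_mul, integral_id]; ring
  simp only [hprim] at lc
  have hL : ∫⁻ x, ENNReal.ofReal (x ^ 2) ∂μ = ENNReal.ofReal (∫ x in Ioc X N, x ^ 2 / θ x) := by
    rw [ofReal_integral_eq_lintegral_ofReal hsq hsq0, hμ,
      lintegral_withDensity_eq_lintegral_mul _ hdm (by fun_prop)]
    refine setLIntegral_congr_fun measurableSet_Ioc fun x hx => ?_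
    simp only [Pi.mul_apply]
    rw [← ENNReal.ofReal_mul (hpos x (hX0.trans hx.1))]
    congr 1; ring
  have hR : ∫⁻ t in Ioi 0, μ {a | t ≤ a} * ENNReal.ofReal (2 * t) ≤
      ENNReal.ofReal (2 * X * X * (∫ z in Ioi X, 1 / θ z)) +
      ENNReal.ofReal ((1 / m) * ∫ x in Ioc X N, x ^ 2 / θ x) := by
    have hU : Ioi (0:ℝ) = Ioc 0 X ∪ (Ioc X N ∪ Ioi N) := by
      rw [Ioc_union_Ioi_eq_Ioi hN, Ioc_union_Ioi_eq_Ioi hX0.le]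
    rw [hU]
    refine (lintegral_union_le _ _ _).trans (add_le_add ?_ ((lintegral_union_le _ _ _).trans ?_))
    · calc ∫⁻ t in Ioc 0 X, μ {a | t ≤ a} * ENNReal.ofReal (2 * t)
          ≤ ∫⁻ t in Ioc 0 X, ENNReal.ofReal (∫ z in Ioi X, 1 / θ z) * ENNReal.ofReal (2 * X) := by
            refine setLIntegral_mono measurable_const fun t ht => ?_
            refine mul_le_mul' ?_ (ENNReal.ofReal_le_ofReal (by linarith [ht.2]))
            refine le_trans ?_ (hμle X le_rfl)
            have e1 : μ {a | X ≤ a}ᶜ = 0 := by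
              rw [hμ]
              refine (withDensity_absolutelyContinuous _ _) ?_
              rw [Measure.restrict_apply (measurableSet_le measurable_const measurable_id').compl]
              convert measure_empty (μ := volume)
              ext a; simp only [mem_inter_iff, mem_compl_iff, mem_setOf_eq, mem_Ioc,
                mem_empty_iff_false, iff_false]
              rintro ⟨h1, h2⟩; exact h1 h2.1.le
            calc μ {a | t ≤ a} ≤ μ ({a | X ≤ a} ∪ {a | X ≤ a}ᶜ) := measure_mono (by simp)
              _ ≤ μ {a | X ≤ a} + μ {a | X ≤ a}ᶜ := measure_union_le _ _
              _ = μ {a | X ≤ a} := by rw [e1, add_zero]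
        _ = _ := by
            rw [setLIntegral_const, Real.volume_Ioc, ← ENNReal.ofReal_mul (hT0 X le_rfl),
              ← ENNReal.ofReal_mul (by have := hT0 X le_rfl; positivity)]
            congr 1; ring
    · have z : ∫⁻ t in Ioi N, μ {a | t ≤ a} * ENNReal.ofReal (2 * t) = 0 := by
        rw [← lintegral_zero (μ := volume.restrict (Ioi N))]
        refine setLIntegral_congr_fun measurableSet_Ioi fun t ht => ?_
        have : μ {a | t ≤ a} = 0 := by
          rw [hμ]
          refine (withDensity_absolutelyContinuous _ _) ?_
          rw [Measure.restrict_apply (measurableSet_le measurable_const measurable_id')]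
          convert measure_empty (μ := volume)
          ext a; simp only [mem_inter_iff, mem_setOf_eq, mem_Ioc,
            mem_empty_iff_false, iff_false]
          rintro ⟨h1, h2⟩; have : N < t := ht; linarith [h2.2]
        simp [this]
      rw [z, add_zero, ← integral_const_mul,
        ofReal_integral_eq_lintegral_ofReal (hsq.const_mul _) (by
          filter_upwards [hsq0] with x hx
          have : 0 ≤ x ^ 2 / θ x := hx
          simp only [Pi.zero_apply]; positivity)]
      refine setLIntegral_mono (by fun_prop) fun t ht => ?_
      refine (mul_le_mul_left (hμle t ht.1.le) _).trans ?_
      rw [← ENNReal.ofReal_mul (hT0 t ht.1.le)]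
      refine ENNReal.ofReal_le_ofReal ?_
      have h1 := h t ht.1.le
      have ht0 : 0 < t := hX0.trans ht.1
      rw [one_div_mul_eq_div, le_div_iff₀ (by linarith)]
      calc (∫ z in Ioi t, 1 / θ z) * (2 * t) * m = t * (2 * m * (∫ z in Ioi t, 1 / θ z)) := by ring
        _ ≤ t * (t / θ t) := by gcongr
        _ = _ := by ring
  have hI0 : 0 ≤ ∫ x in Ioc X N, x ^ 2 / θ x := integral_nonneg_of_ae hsq0
  rw [← lc, hL, ← ENNReal.ofReal_add (by have := hT0 X le_rfl; positivity) (by positivity),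
    ENNReal.ofReal_le_ofReal_iff (by have := hT0 X le_rfl; positivity)] at hR
  exact hR

lemma aux_second_moment {θ : ℝ → ℝ} {bl bh : ℝ} (hθ : ThetaOK θ) (hC2 : CondC2 θ bl bh) :
    IntegrableOn (fun x => x ^ 2 / θ x) (Ioi 0) := by
  obtain ⟨hb1, -, -, -, hlim, -⟩ := hC2
  obtain ⟨m, hm1, hmb⟩ := exists_between hb1
  have hT0 : ∀ t, 0 < t → 0 ≤ ∫ z in Ioi t, 1 / θ z := fun t ht =>
    setIntegral_nonneg measurableSet_Ioi fun z hz => by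
      have := hθ.2.1 z (lt_trans ht hz)
      positivity
  have hev : ∀ᶠ x in atTop, m < (x / θ x) / piF θ (1 / x) := by
    refine eventually_lt_of_lt_liminf (by rw [hlim]; exact hmb) ?_
    refine ⟨0, ?_⟩
    rw [eventually_map]
    filter_upwards [eventually_gt_atTop 0] with x hx
    have := hθ.2.1 x hx
    have := hT0 x hx
    simp only [piF, one_div_one_div, ge_iff_le]
    positivity
  obtain ⟨X0, hX0⟩ := eventually_atTop.1 hev
  set X := max X0 1 with hXdef
  have hX1 : 1 ≤ X := le_max_right _ _
  have h : ∀ x, X ≤ x → 2 * m * (∫ z in Ioi x, 1 / θ z) ≤ x / θ x := by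
    intro x hx
    have h1 := hX0 x ((le_max_left _ _).trans hx)
    simp only [piF, one_div_one_div] at h1
    have hx0 : 0 < x := by linarith
    rcases (hT0 x hx0).eq_or_lt with h0 | h0
    · rw [← h0] at h1; simp at h1; linarith
    · rw [lt_div_iff₀ (by positivity)] at h1
      linarith
  have hbd : ∀ N, X ≤ N → ∫ x in Ioc X N, x ^ 2 / θ x ≤
      (2 * X * X * (∫ z in Ioi X, 1 / θ z)) / (1 - 1 / m) := by
    intro N hN
    have h2 := aux_lin hθ hm1 hX1 h hN
    have : 1 / m < 1 := by rw [div_lt_one (by linarith)]; exact hm1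
    rw [le_div_iff₀ (by linarith)]
    linarith
  have hloc : ∀ N, IntegrableOn (fun x => x ^ 2 / θ x) (Ioc X N) := fun N =>
    (aux_sq_loc hθ (le_max_right N 1)).mono_set
      (Ioc_subset_Ioc (by linarith) (le_max_left _ _))
  have hI : IntegrableOn (fun x => x ^ 2 / θ x) (Ioi X) := by
    refine integrableOn_Ioi_of_intervalIntegral_norm_bounded (l := atTop) (b := fun N : ℝ => N)
      ((2 * X * X * (∫ z in Ioi X, 1 / θ z)) / (1 - 1 / m)) X hloc tendsto_id ?_
    · filter_upwards [eventually_ge_atTop X] with N hN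
      rw [intervalIntegral.integral_of_le hN]
      refine le_trans (le_of_eq ?_) (hbd N hN)
      refine setIntegral_congr_fun measurableSet_Ioc fun x hx => ?_
      have hx0 : 0 < x := by linarith [hx.1]
      have := hθ.2.1 x hx0
      exact Real.norm_of_nonneg (by positivity)
  have := (aux_sq_loc hθ hX1).union hI
  rwa [Ioc_union_Ioi_eq_Ioi (by linarith)] at this

lemma aux_psi_meas {θ : ℝ → ℝ} (hθ : ThetaOK θ) : Measurable (psiF θ) := by
  have hm := hθ.1
  have : StronglyMeasurable (fun l => ∫ x in Ioi (0:ℝ), (1 - Real.cos (x * l)) / θ x) := by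
    refine StronglyMeasurable.integral_prod_right (f := fun l x => (1 - Real.cos (x * l)) / θ x) ?_
    refine Measurable.stronglyMeasurable ?_
    unfold Function.uncurry
    fun_prop
  exact this.measurable

lemma aux_cos_up (u : ℝ) : 1 - Real.cos u ≤ u ^ 2 / 2 := by
  linarith [Real.one_sub_sq_div_two_le_cos (x := u)]

lemma aux_psi_int {θ : ℝ → ℝ} (hθ : ThetaOK θ)
    (hM : IntegrableOn (fun x => x ^ 2 / θ x) (Ioi 0)) (l : ℝ) :
    IntegrableOn (fun x => (1 - Real.cos (x * l)) / θ x) (Ioi 0) := by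
  have hm := hθ.1
  refine Integrable.mono' (hM.const_mul (l ^ 2 / 2)) (Measurable.aestronglyMeasurable (by fun_prop)) ?_
  filter_upwards [ae_restrict_mem measurableSet_Ioi] with x hx
  have := hθ.2.1 x hx
  have h1 := Real.cos_le_one (x * l)
  rw [Real.norm_of_nonneg (div_nonneg (by linarith) this.le), ← mul_div_assoc]
  gcongr
  have := aux_cos_up (x * l)
  nlinarith

lemma aux_psi_nonneg {θ : ℝ → ℝ} (hθ : ThetaOK θ) (l : ℝ) : 0 ≤ psiF θ l :=
  setIntegral_nonneg measurableSet_Ioi fun x hx =>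
    div_nonneg (by linarith [Real.cos_le_one (x * l)]) (hθ.2.1 x hx).le

lemma aux_psi_up {θ : ℝ → ℝ} (hθ : ThetaOK θ)
    (hM : IntegrableOn (fun x => x ^ 2 / θ x) (Ioi 0)) (l : ℝ) :
    psiF θ l ≤ (∫ x in Ioi 0, x ^ 2 / θ x) * l ^ 2 := by
  rw [mul_comm, ← integral_const_mul]
  refine setIntegral_mono_on (aux_psi_int hθ hM l) (hM.const_mul _) measurableSet_Ioi ?_
  intro x hx
  have := hθ.2.1 x hx
  rw [← mul_div_assoc]
  gcongr
  have := aux_cos_up (x * l)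
  nlinarith [sq_nonneg (x * l)]

lemma aux_psi_low {θ : ℝ → ℝ} (hθ : ThetaOK θ)
    (hM : IntegrableOn (fun x => x ^ 2 / θ x) (Ioi 0)) (l : ℝ) (hl : 0 < l) (hl1 : l ≤ 1) :
    (2 / Real.pi ^ 2 * ∫ x in Ioc 0 1, x ^ 2 / θ x) * l ^ 2 ≤ psiF θ l := by
  have hs : Ioc (0:ℝ) 1 ⊆ Ioi 0 := Ioc_subset_Ioi_self
  have hi := aux_psi_int hθ hM l
  have h1 : ∫ x in Ioc (0:ℝ) 1, (1 - Real.cos (x * l)) / θ x ≤ psiF θ l := by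
    refine setIntegral_mono_set hi ?_ hs.eventuallyLE
    filter_upwards [ae_restrict_mem measurableSet_Ioi] with x hx
    exact div_nonneg (by linarith [Real.cos_le_one (x * l)]) (hθ.2.1 x hx).le
  refine le_trans ?_ h1
  rw [mul_right_comm, ← integral_const_mul]
  refine setIntegral_mono_on ((hM.mono_set hs).const_mul _) (hi.mono_set hs) measurableSet_Ioc ?_
  intro x hx
  have := hθ.2.1 x hx.1
  rw [← mul_div_assoc]
  gcongr
  have hxl : |x * l| ≤ Real.pi := by
    rw [abs_of_nonneg (mul_nonneg hx.1.le hl.le)]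
    have := mul_le_one₀ hx.2 hl.le hl1
    linarith [Real.pi_gt_three]
  have := Real.cos_le_one_sub_mul_cos_sq hxl
  calc 2 / Real.pi ^ 2 * l ^ 2 * x ^ 2 = 2 / Real.pi ^ 2 * (x * l) ^ 2 := by ring
    _ ≤ _ := by linarith

lemma aux_pos {θ : ℝ → ℝ} (hθ : ThetaOK θ) : 0 < ∫ x in Ioc 0 1, x ^ 2 / θ x := by
  rw [setIntegral_pos_iff_support_of_nonneg_ae]
  · have : Function.support (fun x => x ^ 2 / θ x) ∩ Ioc 0 1 = Ioc 0 1 := by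
      refine inter_eq_right.2 fun x hx => ?_
      have := hθ.2.1 x hx.1
      have := hx.1
      exact (by positivity : 0 < x ^ 2 / θ x).ne'
    rw [this]; simp
  · filter_upwards [ae_restrict_mem measurableSet_Ioc] with x hx
    have := hθ.2.1 x hx.1
    simp only [Pi.zero_apply]; positivity
  · exact aux_sq_loc hθ le_rfl

/-- Abstract comparison: everything follows from `c l² ≤ ψ(l) ≤ M l²` on `(0,1]`. -/
lemma aux_main {θ : ℝ → ℝ} (hθ : ThetaOK θ) (hψ : PsiIntegrable θ) {c M : ℝ} (hc : 0 < c)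
    (hM : 0 < M) (hlow : ∀ l, 0 < l → l ≤ 1 → c * l ^ 2 ≤ psiF θ l)
    (hup : ∀ l, psiF θ l ≤ M * l ^ 2) :
    ∃ a b : ℝ, 0 < a ∧ ∀ x, 2 ≤ x →
      a ≤ sigma0sqHat θ x / phiF θ x ∧ sigma0sqHat θ x / phiF θ x ≤ b := by
  have hmeas := aux_psi_meas hθ
  have hnn := aux_psi_nonneg hθ
  have hgnn : ∀ l, 0 ≤ 1 / psiF θ l := fun l => one_div_nonneg.2 (hnn l)
  set I1 := ∫ l in Ioi (1:ℝ), 1 / psiF θ l with hI1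
  have hI1nn : 0 ≤ I1 := setIntegral_nonneg measurableSet_Ioi fun l _ => hgnn l
  have hgle : ∀ l, 0 < l → l ≤ 1 → 1 / psiF θ l ≤ 1 / c * (l ^ 2)⁻¹ := by
    intro l h0 h1
    rw [← one_div (l ^ 2), one_div_mul_one_div]
    exact one_div_le_one_div_of_le (by positivity) (hlow l h0 h1)
  have hgge : ∀ l, 0 < l → l ≤ 1 → 1 / (M * l ^ 2) ≤ 1 / psiF θ l := by
    intro l h0 h1
    exact one_div_le_one_div_of_le (lt_of_lt_of_le (by positivity) (hlow l h0 h1)) (hup l)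
  -- integrability of 1/ψ away from zero
  have hgloc : ∀ s, 0 < s → s ≤ 1 → IntegrableOn (fun l => 1 / psiF θ l) (Ioc s 1) := by
    intro s hs hs1
    refine Measure.integrableOn_of_bounded (M := 1 / c * (s ^ 2)⁻¹) (by simp)
      (Measurable.aestronglyMeasurable (by fun_prop)) ?_
    filter_upwards [ae_restrict_mem measurableSet_Ioc] with l hl
    rw [Real.norm_of_nonneg (hgnn l)]
    refine (hgle l (hs.trans hl.1) hl.2).trans ?_
    have := hl.1
    gcongr
  have hgint : ∀ s, 0 < s → s ≤ 1 → IntegrableOn (fun l => 1 / psiF θ l) (Ioi s) := by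
    intro s hs hs1
    have := (hgloc s hs hs1).union hψ
    rwa [Ioc_union_Ioi_eq_Ioi hs1] at this
  -- bounds on φ
  have hphi_low : ∀ x, 2 ≤ x → x / (2 * M) ≤ phiF θ x := by
    intro x hx
    have hx0 : 0 < x := by linarith
    have hs1 : 1 / x ≤ 1 := by rw [div_le_one hx0]; linarith
    have hsub : Ioc (1 / x) (2 / x) ⊆ Ioi (1 / x) := Ioc_subset_Ioi_self
    have h2x : 2 / x ≤ 1 := by rw [div_le_one hx0]; exact hx
    have h1 : 1 / (M * (2 / x) ^ 2) * volume.real (Ioc (1 / x) (2 / x)) ≤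
        ∫ l in Ioc (1 / x) (2 / x), 1 / psiF θ l := by
      refine setIntegral_ge_of_const_le_real measurableSet_Ioc (by simp) ?_
        ((hgint _ (by positivity) hs1).mono_set hsub)
      intro l hl
      have hl0 : 0 < l := lt_trans (by positivity) hl.1
      refine le_trans ?_ (hgge l hl0 (hl.2.trans h2x))
      have := hl.2
      gcongr
    have h2 : ∫ l in Ioc (1 / x) (2 / x), 1 / psiF θ l ≤ ∫ l in Ioi (1 / x), 1 / psiF θ l :=
      setIntegral_mono_set (hgint _ (by positivity) hs1)
        (Eventually.of_forall hgnn) hsub.eventuallyLE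
    rw [Real.volume_real_Ioc_of_le (by gcongr; norm_num)] at h1
    have h3 : 1 / (M * (2 / x) ^ 2) * (2 / x - 1 / x) = x / (4 * M) := by field_simp; norm_num
    have h4 : x / (2 * M) = 2 * (x / (4 * M)) := by field_simp; norm_num
    unfold phiF
    rw [h4]; linarith
  have hphi_up : ∀ x, 2 ≤ x → phiF θ x ≤ 2 * (1 / c + I1) * x := by
    intro x hx
    have hx0 : 0 < x := by linarith
    have hs0 : 0 < 1 / x := by positivity
    have hs1 : 1 / x ≤ 1 := by rw [div_le_one hx0]; linarith
    have hcont : ContinuousOn (fun l : ℝ => 1 / c * (l ^ 2)⁻¹) (uIcc (1 / x) 1) := by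
      rw [uIcc_of_le hs1]
      refine continuousOn_const.mul ((continuousOn_id.pow 2).inv₀ ?_)
      intro l hl
      have : 0 < l := lt_of_lt_of_le hs0 hl.1
      exact (pow_pos this 2).ne'
    have hii : IntervalIntegrable (fun l : ℝ => 1 / c * (l ^ 2)⁻¹) volume (1 / x) 1 :=
      hcont.intervalIntegrable
    have hval : ∫ l in (1 / x)..1, 1 / c * (l ^ 2)⁻¹ = 1 / c * (x - 1) := by
      rw [intervalIntegral.integral_eq_sub_of_hasDerivAt (f := fun l => 1 / c * (- l⁻¹)) ?_ hii]
      · simp; ring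
      · intro l hl
        rw [uIcc_of_le hs1] at hl
        have : 0 < l := lt_of_lt_of_le hs0 hl.1
        have := ((hasDerivAt_inv this.ne').neg).const_mul (1 / c)
        simpa using this
    rw [intervalIntegral.integral_of_le hs1] at hval
    have h1 : ∫ l in Ioc (1 / x) 1, 1 / psiF θ l ≤ 1 / c * (x - 1) := by
      rw [← hval]
      refine setIntegral_mono_on (hgloc _ hs0 hs1) hii.1 measurableSet_Ioc ?_
      intro l hl
      exact hgle l (hs0.trans hl.1) hl.2
    unfold phiF
    rw [← Ioc_union_Ioi_eq_Ioi hs1, setIntegral_union Ioc_disjoint_Ioi_same measurableSet_Ioi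
      (hgloc _ hs0 hs1) hψ]
    have : 0 < 1 / c := by positivity
    have e : I1 ≤ I1 * x := by nlinarith
    nlinarith
  -- integrand of σ₀²
  have hFnn : ∀ y l, 0 ≤ (1 - Real.cos (l * y)) / psiF θ l := fun y l =>
    div_nonneg (by linarith [Real.cos_le_one (l * y)]) (hnn l)
  have hFsm : ∀ x y, 2 ≤ x → |y| ≤ x → ∀ l ∈ Ioc 0 (1 / x),
      (1 - Real.cos (l * y)) / psiF θ l ≤ x ^ 2 / c := by
    intro x y hx hy l hl
    have hx0 : 0 < x := by linarith
    have hs1 : 1 / x ≤ 1 := by rw [div_le_one hx0]; linarith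
    have hl0 := hl.1
    have h1 := hlow l hl.1 (hl.2.trans hs1)
    have hp : 0 < psiF θ l := lt_of_lt_of_le (by positivity) h1
    rw [div_le_div_iff₀ hp hc]
    have h2 := aux_cos_up (l * y)
    have hyx : y ^ 2 ≤ x ^ 2 := sq_le_sq' (by linarith [neg_abs_le y]) (by linarith [le_abs_self y])
    calc (1 - Real.cos (l * y)) * c ≤ (l ^ 2 * x ^ 2) * c := by
          gcongr
          refine h2.trans ?_
          have := mul_le_mul_of_nonneg_left hyx (sq_nonneg l)
          nlinarith [sq_nonneg (l * y)]
      _ = x ^ 2 * (c * l ^ 2) := by ring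
      _ ≤ _ := by gcongr
  have hFint1 : ∀ x y, 2 ≤ x → |y| ≤ x →
      IntegrableOn (fun l => (1 - Real.cos (l * y)) / psiF θ l) (Ioc 0 (1 / x)) := by
    intro x y hx hy
    refine Measure.integrableOn_of_bounded (M := x ^ 2 / c) (by simp)
      (Measurable.aestronglyMeasurable (by fun_prop)) ?_
    filter_upwards [ae_restrict_mem measurableSet_Ioc] with l hl
    rw [Real.norm_of_nonneg (hFnn y l)]
    exact hFsm x y hx hy l hl
  have hFle2 : ∀ y l, (1 - Real.cos (l * y)) / psiF θ l ≤ 2 * (1 / psiF θ l) := by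
    intro y l
    rw [← mul_div_assoc, mul_one]
    have := hnn l
    gcongr
    linarith [Real.neg_one_le_cos (l * y)]
  have hFint2 : ∀ x y, 2 ≤ x →
      IntegrableOn (fun l => (1 - Real.cos (l * y)) / psiF θ l) (Ioi (1 / x)) := by
    intro x y hx
    have hx0 : 0 < x := by linarith
    have hs1 : 1 / x ≤ 1 := by rw [div_le_one hx0]; linarith
    refine Integrable.mono' ((hgint _ (by positivity) hs1).const_mul 2) (Measurable.aestronglyMeasurable (by fun_prop)) ?_
    filter_upwards with l
    rw [Real.norm_of_nonneg (hFnn y l)]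
    exact hFle2 y l
  have hsplit : ∀ x y, 2 ≤ x → |y| ≤ x →
      ∫ l in Ioi (0:ℝ), (1 - Real.cos (l * y)) / psiF θ l =
      (∫ l in Ioc 0 (1 / x), (1 - Real.cos (l * y)) / psiF θ l) +
      ∫ l in Ioi (1 / x), (1 - Real.cos (l * y)) / psiF θ l := by
    intro x y hx hy
    have hs0 : 0 ≤ 1 / x := by positivity
    rw [← setIntegral_union Ioc_disjoint_Ioi_same measurableSet_Ioi
      (hFint1 x y hx hy) (hFint2 x y hx), Ioc_union_Ioi_eq_Ioi hs0]
  have hsig_up : ∀ x y, 2 ≤ x → |y| ≤ x → sigma0sq θ y ≤ (2 / Real.pi) * (x / c + phiF θ x) := by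
    intro x y hx hy
    have hx0 : 0 < x := by linarith
    have hs0 : 0 ≤ 1 / x := by positivity
    have hs1 : 1 / x ≤ 1 := by rw [div_le_one hx0]; linarith
    have h1 : ∫ l in Ioc 0 (1 / x), (1 - Real.cos (l * y)) / psiF θ l ≤ x / c := by
      have := norm_setIntegral_le_of_norm_le_const (μ := volume) (s := Ioc 0 (1 / x))
        (f := fun l => (1 - Real.cos (l * y)) / psiF θ l) (C := x ^ 2 / c) (by simp)
        (fun l hl => by rw [Real.norm_of_nonneg (hFnn y l)]; exact hFsm x y hx hy l hl)
      rw [Real.volume_real_Ioc_of_le hs0] at this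
      refine (le_abs_self _).trans (this.trans (le_of_eq ?_))
      field_simp
      ring
    have h2 : ∫ l in Ioi (1 / x), (1 - Real.cos (l * y)) / psiF θ l ≤ phiF θ x := by
      unfold phiF
      rw [← integral_const_mul]
      exact integral_mono (hFint2 x y hx) ((hgint _ (by positivity) hs1).const_mul 2)
        (fun l => hFle2 y l)
    unfold sigma0sq
    rw [hsplit x y hx hy]
    have := Real.pi_pos
    gcongr
  have hsig_low : ∀ x, 2 ≤ x →
      (2 / Real.pi) * (2 / (Real.pi ^ 2 * M)) * x ≤ sigma0sq θ x := by
    intro x hx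
    have hpi := Real.pi_pos
    have hx0 : 0 < x := by linarith
    have hs0 : 0 ≤ 1 / x := by positivity
    have hs1 : 1 / x ≤ 1 := by rw [div_le_one hx0]; linarith
    have hxx : |x| ≤ x := (abs_of_pos hx0).le
    have h1 : 2 / (Real.pi ^ 2 * M) * x ^ 2 * volume.real (Ioc 0 (1 / x)) ≤
        ∫ l in Ioc 0 (1 / x), (1 - Real.cos (l * x)) / psiF θ l := by
      refine setIntegral_ge_of_const_le_real measurableSet_Ioc (by simp) ?_ (hFint1 x x hx hxx)
      intro l hl
      have hl0 := hl.1
      have hp : 0 < psiF θ l := lt_of_lt_of_le (by positivity) (hlow l hl.1 (hl.2.trans hs1))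
      have hlx : l * x ≤ 1 := by have := hl.2; rwa [le_div_iff₀ hx0] at this
      have hcos := Real.cos_le_one_sub_mul_cos_sq (x := l * x) (by
        rw [abs_of_nonneg (by positivity)]; linarith [Real.pi_gt_three])
      rw [le_div_iff₀ hp]
      calc 2 / (Real.pi ^ 2 * M) * x ^ 2 * psiF θ l
          ≤ 2 / (Real.pi ^ 2 * M) * x ^ 2 * (M * l ^ 2) := by gcongr; exact hup l
        _ = 2 / Real.pi ^ 2 * (l * x) ^ 2 := by field_simp
        _ ≤ _ := by linarith
    rw [Real.volume_real_Ioc_of_le hs0] at h1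
    have h2 : 0 ≤ ∫ l in Ioi (1 / x), (1 - Real.cos (l * x)) / psiF θ l :=
      integral_nonneg (fun l => hFnn x l)
    have h3 : 2 / (Real.pi ^ 2 * M) * x ^ 2 * (1 / x - 0) = 2 / (Real.pi ^ 2 * M) * x := by
      field_simp; ring
    unfold sigma0sq
    rw [hsplit x x hx hxx, mul_assoc]
    gcongr
    linarith
  have hpi := Real.pi_pos
  refine ⟨(2 / Real.pi) * (2 / (Real.pi ^ 2 * M)) / (2 * (1 / c + I1)),
    (2 / Real.pi) * (2 * M / c + 1), by positivity, ?_⟩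
  intro x hx
  have hx0 : 0 < x := by linarith
  have hpl := hphi_low x hx
  have hpu := hphi_up x hx
  have hp : 0 < phiF θ x := lt_of_lt_of_le (by positivity) hpl
  have hub : ∀ z ∈ sigma0sq θ '' {y : ℝ | |y| ≤ x}, z ≤ (2 / Real.pi) * (x / c + phiF θ x) := by
    rintro _ ⟨y, hy, rfl⟩
    exact hsig_up x y hx hy
  have hmem : sigma0sq θ x ∈ sigma0sq θ '' {y : ℝ | |y| ≤ x} := ⟨x, (abs_of_pos hx0).le, rfl⟩
  have hH1 : sigma0sq θ x ≤ sigma0sqHat θ x := le_csSup ⟨_, hub⟩ hmem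
  have hH2 : sigma0sqHat θ x ≤ (2 / Real.pi) * (x / c + phiF θ x) := csSup_le ⟨_, hmem⟩ hub
  have hk : 0 < 2 * (1 / c + I1) := by positivity
  constructor
  · rw [le_div_iff₀ hp]
    refine le_trans ?_ ((hsig_low x hx).trans hH1)
    rw [div_mul_eq_mul_div, div_le_iff₀ hk, mul_assoc _ x]
    gcongr
    linarith
  · rw [div_le_iff₀ hp]
    refine hH2.trans ?_
    rw [mul_assoc]
    gcongr
    rw [add_mul, one_mul]
    gcongr
    rw [div_le_iff₀ (by positivity)] at hpl
    rw [div_mul_eq_mul_div]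
    gcongr
    linarith
/-- Lemma 2.6, Eq. (2.11): under (C2),
    0 < liminf_{x→∞} σ̂₀²(x)/φ(x) ≤ limsup_{x→∞} σ̂₀²(x)/φ(x) < ∞. -/
theorem sigmaHat_comparable_phi_at_infty (θ : ℝ → ℝ) (bl bh : ℝ)
    (hθ : ThetaOK θ) (hψ : PsiIntegrable θ) (hC2 : CondC2 θ bl bh) :
    0 < Filter.liminf (fun x => sigma0sqHat θ x / phiF θ x) Filter.atTop ∧
    Filter.liminf (fun x => sigma0sqHat θ x / phiF θ x) Filter.atTop ≤
      Filter.limsup (fun x => sigma0sqHat θ x / phiF θ x) Filter.atTop ∧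
    Filter.IsBoundedUnder (· ≤ ·) Filter.atTop
      (fun x => sigma0sqHat θ x / phiF θ x) := by
  have hM := aux_second_moment hθ hC2
  have hA := aux_pos hθ
  have hpi := Real.pi_pos
  have hMpos : 0 < ∫ x in Ioi 0, x ^ 2 / θ x := by
    refine lt_of_lt_of_le hA (setIntegral_mono_set hM ?_ Ioc_subset_Ioi_self.eventuallyLE)
    filter_upwards [ae_restrict_mem measurableSet_Ioi] with x hx
    have := hθ.2.1 x hx
    simp only [Pi.zero_apply]; positivity
  obtain ⟨a, b, ha, hab⟩ := aux_main hθ hψ (mul_pos (by positivity) hA) hMpos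
    (aux_psi_low hθ hM) (aux_psi_up hθ hM)
  have hbu : IsBoundedUnder (· ≤ ·) atTop (fun x => sigma0sqHat θ x / phiF θ x) :=
    isBoundedUnder_of_eventually_le (a := b)
      ((eventually_ge_atTop 2).mono fun x hx => (hab x hx).2)
  have hev : ∀ᶠ x in atTop, a ≤ sigma0sqHat θ x / phiF θ x :=
    (eventually_ge_atTop 2).mono fun x hx => (hab x hx).1
  refine ⟨lt_of_lt_of_le ha (le_liminf_of_le hbu.isCoboundedUnder_ge hev), ?_, hbu⟩
  exact liminf_le_limsup hbu (isBoundedUnder_of_eventually_ge hev)
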